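/- For every integer p ≥ 0 and every integer n ≥ 1, there exists f ∈ F such that the commutator [D_p, t̄_n·] of ℚ-linear endomorphisms of R equals: (1/m)·∂_{t̄_{(p−1)m−n}} + f· if n < (p−1)m; ((n−(p−1)m)/m)·(multiplication by t̄_{n−(p−1)m}) + f· if n > (p−1)m; (1/m)·(multiplication by x_0) + f· if n = (p−1)m. -/

import Mathlib

open MvPolynomial

noncomputable section

namespace EBTH

/-- Variables of the polynomial ring: `x n` for `n ≥ 0`, `t n` and `tb n` ("t-bar")
for `n ≥ 1` (indexed by positive naturals). -/
inductive Var : Type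
  | x : ℕ → Var
  | t : {n : ℕ // 0 < n} → Var
  | tb : {n : ℕ // 0 < n} → Var
  deriving DecidableEq

/-- The polynomial algebra `R = ℚ[x₀, x₁, …; t₁, t₂, …; t̄₁, t̄₂, …]`. -/
abbrev P : Type := MvPolynomial Var ℚ

/-- The variable `t n`; intended (and only used) for `n ≥ 1`. -/
def tv (n : ℕ) : Var := Var.t ⟨max n 1, by omega⟩

/-- The variable `t̄ n`; intended (and only used) for `n ≥ 1`. -/
def tbv (n : ℕ) : Var := Var.tb ⟨max n 1, by omega⟩

/-- Multiplication by a polynomial, as a `ℚ`-linear endomorphism. -/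
def mul (f : P) : Module.End ℚ P := LinearMap.mulLeft ℚ f

/-- The partial derivative `∂_v`, as a `ℚ`-linear endomorphism. -/
def pd (v : Var) : Module.End ℚ P := (MvPolynomial.pderiv v).toLinearMap

/-- The commutator `[P,Q] = PQ − QP` of endomorphisms. -/
def comm (f g : Module.End ℚ P) : Module.End ℚ P := f * g - g * f

/-- The first-order (locally finite) part of `D₀`, i.e. the derivation
`(1/k)·Σ_{n≥1}( x_{n+1}·∂_{t_{nk}} + (n+k)·t_{n+k}·∂_{t_n} )
 + (1/m)·Σ_{n≥1}( x_{n+1}·∂_{t̄_{nm}} + (n+m)·t̄_{n+m}·∂_{t̄_n} )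
 + Σ_{n≥1} n·x_n·∂_{x_{n−1}}`,
encoded by its values on the variables. -/
def D0der (k m : ℕ) : Module.End ℚ P :=
  (mkDerivation ℚ fun v => match v with
    | Var.x j => ((j : ℚ) + 1) • X (Var.x (j + 1))
    | Var.t j => (((j : ℚ) + k) / k) • X (tv ((j : ℕ) + k))
        + (if k ∣ (j : ℕ) then (1 / (k : ℚ)) • X (Var.x ((j : ℕ) / k + 1)) else 0)
    | Var.tb j => (((j : ℚ) + m) / m) • X (tbv ((j : ℕ) + m))
        + (if m ∣ (j : ℕ) then (1 / (m : ℚ)) • X (Var.x ((j : ℕ) / m + 1)) else 0)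
  ).toLinearMap

/-- The zero-order part of `D₀`: the polynomial
`(1/(2k))·Σ_{n=1}^{k−1} n(k−n)·t_n t_{k−n} + (1/(2m))·Σ_{n=1}^{m−1} n(m−n)·t̄_n t̄_{m−n}
 + (1/k + 1/m)·x₀x₁ + x₀(t_k + t̄_m)`. -/
def Q0 (k m : ℕ) : P :=
  (1 / (2 * (k : ℚ))) • (∑ i ∈ Finset.range (k - 1),
      (((i : ℚ) + 1) * ((k : ℚ) - ((i : ℚ) + 1))) • (X (tv (i + 1)) * X (tv (k - (i + 1)))))
  + (1 / (2 * (m : ℚ))) • (∑ i ∈ Finset.range (m - 1),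
      (((i : ℚ) + 1) * ((m : ℚ) - ((i : ℚ) + 1))) • (X (tbv (i + 1)) * X (tbv (m - (i + 1)))))
  + ((1 / (k : ℚ)) + (1 / (m : ℚ))) • (X (Var.x 0) * X (Var.x 1))
  + X (Var.x 0) * (X (tv k) + X (tbv m))

/-- The first-order part of `D₁`, i.e. the derivation
`(1/k)·Σ_{n≥1}( x_n·∂_{t_{nk}} + n·t_n·∂_{t_n} )
 + (1/m)·Σ_{n≥1}( x_n·∂_{t̄_{nm}} + n·t̄_n·∂_{t̄_n} ) + Σ_{n≥1} n·x_n·∂_{x_n}`. -/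
def D1der (k m : ℕ) : Module.End ℚ P :=
  (mkDerivation ℚ fun v => match v with
    | Var.x j => (j : ℚ) • X (Var.x j)
    | Var.t j => ((j : ℚ) / k) • X (Var.t j)
        + (if k ∣ (j : ℕ) then (1 / (k : ℚ)) • X (Var.x ((j : ℕ) / k)) else 0)
    | Var.tb j => ((j : ℚ) / m) • X (Var.tb j)
        + (if m ∣ (j : ℕ) then (1 / (m : ℚ)) • X (Var.x ((j : ℕ) / m)) else 0)
  ).toLinearMap

/-- The first-order part of `D_{p+1}` for `p ≥ 1`, i.e. the derivation
`Σ_{n≥1} n·x_n·∂_{x_{p+n}} + (1/k)·Σ_{n≥0}( x_n·∂_{t_{(p+n)k}} + n·t_n·∂_{t_{pk+n}} )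
 + (1/m)·Σ_{n≥0}( x_n·∂_{t̄_{(p+n)m}} + n·t̄_n·∂_{t̄_{pm+n}} )`. -/
def Dbigder (k m p : ℕ) : Module.End ℚ P :=
  (mkDerivation ℚ fun v => match v with
    | Var.x j => if p < j then ((j : ℚ) - (p : ℚ)) • X (Var.x (j - p)) else 0
    | Var.t j =>
        (if k ∣ (j : ℕ) ∧ p ≤ (j : ℕ) / k then
            (1 / (k : ℚ)) • X (Var.x ((j : ℕ) / k - p)) else 0)
        + (if p * k < (j : ℕ) then
            (((j : ℚ) - (p : ℚ) * k) / k) • X (tv ((j : ℕ) - p * k)) else 0)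
    | Var.tb j =>
        (if m ∣ (j : ℕ) ∧ p ≤ (j : ℕ) / m then
            (1 / (m : ℚ)) • X (Var.x ((j : ℕ) / m - p)) else 0)
        + (if p * m < (j : ℕ) then
            (((j : ℚ) - (p : ℚ) * m) / m) • X (tbv ((j : ℕ) - p * m)) else 0)
  ).toLinearMap

/-- The second-order part of `D_{p+1}` for `p ≥ 1`:
`(1/(2k))·Σ_{n=1}^{pk−1} ∂_{t_n}∂_{t_{pk−n}} + (1/(2m))·Σ_{n=1}^{pm−1} ∂_{t̄_n}∂_{t̄_{pm−n}}`. -/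
def Dbig2 (k m p : ℕ) : Module.End ℚ P :=
  (1 / (2 * (k : ℚ))) • (∑ i ∈ Finset.range (p * k - 1),
      pd (tv (i + 1)) * pd (tv (p * k - (i + 1))))
  + (1 / (2 * (m : ℚ))) • (∑ i ∈ Finset.range (p * m - 1),
      pd (tbv (i + 1)) * pd (tbv (p * m - (i + 1))))

/-- The operators `D_p` (`p ≥ 0`) from Section 4.4 of the paper. -/
def D (k m : ℕ) : ℕ → Module.End ℚ P
  | 0 => D0der k m + mul (Q0 k m)
  | 1 => D1der k m
      + mul (((1 / (2 * (k : ℚ))) + (1 / (2 * (m : ℚ)))) • (X (Var.x 0) * X (Var.x 0)))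
  | (p + 2) => Dbigder k m (p + 1) + Dbig2 k m (p + 1)

/-- The subalgebra `F = ℚ[x₁, x₂, …]` of polynomials involving none of the
variables `x₀, t_n, t̄_n`. -/
def Fsub : Subalgebra ℚ P := Algebra.adjoin ℚ (Set.range fun n : ℕ => X (Var.x (n + 1)))

end EBTH

namespace EBTH

lemma comm_add_left (A B C : Module.End ℚ P) : comm (A + B) C = comm A C + comm B C := by
  simp only [comm, add_mul, mul_add]; abel

lemma comm_smul_left (c : ℚ) (A C : Module.End ℚ P) : comm (c • A) C = c • comm A C := by
  simp only [comm, smul_mul_assoc, mul_smul_comm, smul_sub]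

lemma comm_sum_left {ι : Type*} (s : Finset ι) (A : ι → Module.End ℚ P) (C : Module.End ℚ P) :
    comm (∑ i ∈ s, A i) C = ∑ i ∈ s, comm (A i) C := by
  simp only [comm, Finset.sum_mul, Finset.mul_sum, Finset.sum_sub_distrib]

lemma comm_mul_mul (f g : P) : comm (mul f) (mul g) = 0 := by
  refine LinearMap.ext fun r => ?_
  simp only [comm, mul, LinearMap.sub_apply, Module.End.mul_apply, LinearMap.mulLeft_apply,
    LinearMap.zero_apply]
  ring

lemma comm_derivation_mul (d : Derivation ℚ P P) (f : P) :
    comm d.toLinearMap (mul f) = mul (d f) := by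
  refine LinearMap.ext fun r => ?_
  simp only [comm, mul, LinearMap.sub_apply, Module.End.mul_apply, LinearMap.mulLeft_apply,
    Derivation.coeFn_coe, Derivation.leibniz, smul_eq_mul]
  ring

lemma mul_add_left (f g : P) : mul (f + g) = mul f + mul g :=
  LinearMap.ext fun r => add_mul f g r

lemma mul_smul_left (c : ℚ) (f : P) : mul (c • f) = c • mul f :=
  LinearMap.ext fun r => smul_mul_assoc c f r

lemma mul_zero_left : mul 0 = 0 :=
  LinearMap.ext fun r => zero_mul r

set_option linter.unnecessarySeqFocus false in
lemma comm_pd_pd_X (a b c : Var) :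
    comm (pd a * pd b) (mul (X c))
      = (if c = b then pd a else 0) + (if c = a then pd b else 0) := by
  refine LinearMap.ext fun r => ?_
  have h : ∀ u : Var, pderiv u (X c : P) = if c = u then 1 else 0 := fun u => by
    rw [pderiv_X]; simp [Pi.single_apply]
  simp only [comm, mul, pd, LinearMap.sub_apply, Module.End.mul_apply, LinearMap.mulLeft_apply,
    Derivation.coeFn_coe, Derivation.leibniz, smul_eq_mul, map_add,
    h, LinearMap.add_apply]
  split_ifs <;> simp <;> ring

lemma tbv_inj {a b : ℕ} (ha : 1 ≤ a) (hb : 1 ≤ b) : tbv a = tbv b ↔ a = b := by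
  simp only [tbv, Var.tb.injEq, Subtype.mk.injEq]
  omega

lemma tbv_ne_tv (a b : ℕ) : tbv a ≠ tv b := by
  simp [tbv, tv]

lemma X_succ_mem_Fsub {j : ℕ} (hj : 1 ≤ j) : (X (Var.x j) : P) ∈ Fsub :=
  Algebra.subset_adjoin ⟨j - 1, by simp [Nat.sub_add_cancel hj]⟩

lemma comm_D_zero (k m n : ℕ) (hn : 1 ≤ n) :
    comm (D k m 0) (mul (X (tbv n)))
      = (((n : ℚ) + m) / m) • mul (X (tbv (n + m)))
        + mul (if m ∣ n then (1 / (m : ℚ)) • X (Var.x (n / m + 1)) else 0) := by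
  rw [D, D0der, comm_add_left, comm_mul_mul, comm_derivation_mul, add_zero, mkDerivation_X,
    ← mul_smul_left, ← mul_add_left]
  simp [tbv, max_eq_left hn]

lemma comm_D_one (k m n : ℕ) (hn : 1 ≤ n) :
    comm (D k m 1) (mul (X (tbv n)))
      = ((n : ℚ) / m) • mul (X (tbv n))
        + mul (if m ∣ n then (1 / (m : ℚ)) • X (Var.x (n / m)) else 0) := by
  rw [D, D1der, comm_add_left, comm_mul_mul, comm_derivation_mul, add_zero, mkDerivation_X,
    ← mul_smul_left, ← mul_add_left]
  simp [tbv, max_eq_left hn]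

lemma comm_Dbigder (k m q n : ℕ) (hn : 1 ≤ n) :
    comm (Dbigder k m q) (mul (X (tbv n)))
      = mul (if m ∣ n ∧ q ≤ n / m then (1 / (m : ℚ)) • X (Var.x (n / m - q)) else 0)
        + (if q * m < n then
            (((n : ℚ) - (q : ℚ) * m) / m) • mul (X (tbv (n - q * m))) else 0) := by
  have h : tbv n = Var.tb ⟨n, hn⟩ := by simp [tbv, max_eq_left hn]
  rw [Dbigder, comm_derivation_mul, h, mkDerivation_X]
  dsimp only
  rw [mul_add_left]
  congr 1
  split_ifs
  · rw [mul_smul_left]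
  · rw [mul_zero_left]

lemma sum_comm_pd_tbv (N n : ℕ) (hn : 1 ≤ n) :
    ∑ i ∈ Finset.range (N - 1),
        comm (pd (tbv (i + 1)) * pd (tbv (N - (i + 1)))) (mul (X (tbv n)))
      = if n < N then (2 : ℚ) • pd (tbv (N - n)) else 0 := by
  have h : ∀ i ∈ Finset.range (N - 1),
      comm (pd (tbv (i + 1)) * pd (tbv (N - (i + 1)))) (mul (X (tbv n)))
        = (if N - n - 1 = i ∧ n < N then pd (tbv (N - n)) else 0)
          + (if n - 1 = i then pd (tbv (N - n)) else 0) := fun i hi => by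
    rw [Finset.mem_range] at hi
    rw [comm_pd_pd_X]
    congr 1
    · refine if_ctx_congr ((tbv_inj hn (by omega)).trans (by omega)) (fun h => ?_) fun _ => rfl
      congr 2; omega
    · refine if_ctx_congr ((tbv_inj hn (by omega)).trans (by omega)) (fun h => ?_) fun _ => rfl
      congr 2; omega
  rw [Finset.sum_congr rfl h, Finset.sum_add_distrib]
  by_cases hN : n < N
  · simp only [hN, and_true, Finset.sum_ite_eq, Finset.mem_range, if_true]
    rw [if_pos (by omega), if_pos (by omega), two_smul]
  · simp only [hN, and_false, Finset.sum_ite_eq, Finset.mem_range, if_false]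
    rw [if_neg (by omega)]
    simp

lemma comm_Dbig2 (k m q n : ℕ) (hn : 1 ≤ n) :
    comm (Dbig2 k m q) (mul (X (tbv n)))
      = if n < q * m then (1 / (m : ℚ)) • pd (tbv (q * m - n)) else 0 := by
  rw [Dbig2, comm_add_left, comm_smul_left, comm_smul_left, comm_sum_left, comm_sum_left,
    sum_comm_pd_tbv _ _ hn]
  simp only [comm_pd_pd_X, tbv_ne_tv, if_false, add_zero, Finset.sum_const_zero, smul_zero,
    zero_add]
  split_ifs
  · rw [smul_smul]
    congr 1
    rw [one_div, mul_inv]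
    ring
  · simp

end EBTH

open EBTH in
/-- for `p ≥ 0`, `n ≥ 1`, there exists `f ∈ F` such that
`[D_p, t̄_n·]` equals `(1/m)·∂_{t̄_{(p−1)m−n}} + f·` if `n < (p−1)m`;
`((n−(p−1)m)/m)·(t̄_{n−(p−1)m}·) + f·` if `n > (p−1)m`;
and `(1/m)·(x₀·) + f·` if `n = (p−1)m`. -/
theorem stmt6 (k m : ℕ) (hk : 0 < k) (hm : 0 < m) (p n : ℕ) (hn : 1 ≤ n) :
    ∃ f ∈ Fsub,
      ((n : ℤ) < ((p : ℤ) - 1) * m →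
        comm (D k m p) (mul (X (tbv n)))
          = (1 / (m : ℚ)) • pd (tbv ((((p : ℤ) - 1) * m - n).toNat)) + mul f) ∧
      (((p : ℤ) - 1) * m < (n : ℤ) →
        comm (D k m p) (mul (X (tbv n)))
          = ((((n : ℚ) - ((p : ℚ) - 1) * m)) / m)
              • mul (X (tbv (((n : ℤ) - ((p : ℤ) - 1) * m).toNat))) + mul f) ∧
      ((n : ℤ) = ((p : ℤ) - 1) * m →
        comm (D k m p) (mul (X (tbv n)))
          = (1 / (m : ℚ)) • mul (X (Var.x 0)) + mul f) := by
  have hm' : (0 : ℤ) < m := by exact_mod_cast hm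
  match p with
  | 0 =>
    refine ⟨if m ∣ n then (1 / (m : ℚ)) • X (Var.x (n / m + 1)) else 0, ?_, fun h => ?_, fun _ => ?_, fun h => ?_⟩
    rotate_left 2
    · rw [comm_D_zero k m n hn]
      congr 3
      · push_cast; ring
      · congr 2
        push_cast
        omega
    · push_cast at h; omega
    · split_ifs
      · exact Fsub.smul_mem (X_succ_mem_Fsub (Nat.le_add_left 1 _)) _
      · exact Fsub.zero_mem
    · push_cast at h; omega
  | 1 =>
    refine ⟨if m ∣ n then (1 / (m : ℚ)) • X (Var.x (n / m)) else 0, ?_, fun h => ?_, fun _ => ?_, fun h => ?_⟩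
    rotate_left 2
    · rw [comm_D_one k m n hn]
      congr 3
      · push_cast; ring
      · congr 2
        push_cast
        omega
    · push_cast at h; omega
    · split_ifs with hd
      · exact Fsub.smul_mem (X_succ_mem_Fsub (Nat.div_pos (Nat.le_of_dvd hn hd) hm)) _
      · exact Fsub.zero_mem
    · push_cast at h; omega
  | q + 2 =>
    have hz : (((q + 2 : ℕ) : ℤ) - 1) * m = (((q + 1) * m : ℕ) : ℤ) := by push_cast; ring
    have hq : (((q + 2 : ℕ) : ℚ) - 1) * m = ((q + 1 : ℕ) : ℚ) * m := by push_cast; ring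
    rw [hz, hq, D, comm_add_left, comm_Dbigder k m _ n hn, comm_Dbig2 k m _ n hn]
    simp only [Nat.cast_lt, Nat.cast_inj]
    have hle : q + 1 ≤ n / m ↔ (q + 1) * m ≤ n := Nat.le_div_iff_mul_le hm
    rcases lt_trichotomy n ((q + 1) * m) with h | h | h
    · refine ⟨0, Fsub.zero_mem, fun _ => ?_, fun h' => by omega, fun h' => by omega⟩
      rw [if_neg (fun h' => by have := hle.1 h'.2; omega), if_neg (by omega), if_pos h,
        mul_zero_left, add_zero, zero_add, add_zero]
      congr 3
      omega
    · refine ⟨0, Fsub.zero_mem, fun h' => by omega, fun h' => by omega, fun _ => ?_⟩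
      rw [if_pos ⟨h ▸ Dvd.intro_left _ rfl, hle.2 h.ge⟩, if_neg (by omega), if_neg (by omega),
        h, Nat.mul_div_cancel _ hm, Nat.sub_self, mul_zero_left, mul_smul_left, add_zero]
    · refine ⟨if m ∣ n ∧ q + 1 ≤ n / m then
        (1 / (m : ℚ)) • X (Var.x (n / m - (q + 1))) else 0, ?_,
        fun h' => by omega, fun _ => ?_, fun h' => by omega⟩
      rotate_left
      · rw [if_pos h, if_neg (by omega : ¬ n < (q + 1) * m), add_zero, add_comm,
          Int.toNat_sub]
      · split_ifs with hd
        · refine Fsub.smul_mem (X_succ_mem_Fsub ?_) _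
          have : q + 1 < n / m := by
            rwa [Nat.lt_div_iff_mul_lt_of_dvd hm.ne' hd.1]
          omega
        · exact Fsub.zero_mem
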